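/- Let n ≥ 1, K > 0, let x₁,…,x_m ∈ L^n_K, let ω₁,…,ω_m be nonnegative reals with Σᵢωᵢ > 0, and set a = Σᵢ₌₁^m ωᵢxᵢ. Then the Lorentzian focal point μ_F = √K · a / |‖a‖_L| lies on L^n_K and is the unique extremizer over L^n_K of the weighted sum of Lorentzian scalar products μ ↦ Σᵢ₌₁^m ωᵢ⟨xᵢ, μ⟩_L = ⟨a, μ⟩_L: for every μ ∈ L^n_K one has ⟨a, μ⟩_L ≤ ⟨a, μ_F⟩_L = −√K·|‖a‖_L|, with equality if and only if μ = μ_F. -/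

import Mathlib

open Finset

/-- The Lorentzian scalar product on `ℝ^{n+1}` (coordinates indexed `0, …, n`):
`⟨x,y⟩_L = −x₀y₀ + ∑_{i=1}^n xᵢyᵢ`. -/
def lorentzInner {n : ℕ} (x y : Fin (n + 1) → ℝ) : ℝ :=
  -(x 0 * y 0) + ∑ i : Fin n, x i.succ * y i.succ

theorem lorentzInner_comm {n : ℕ} (x y : Fin (n + 1) → ℝ) :
    lorentzInner x y = lorentzInner y x := by
  simp only [lorentzInner, mul_comm]

theorem lorentzInner_smul_left {n : ℕ} (c : ℝ) (x y : Fin (n + 1) → ℝ) :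
    lorentzInner (c • x) y = c * lorentzInner x y := by
  simp only [lorentzInner, Pi.smul_apply, smul_eq_mul, mul_add, Finset.mul_sum, mul_assoc, mul_neg]

theorem lorentzInner_sum_smul_left {n : ℕ} {ι : Type*} (s : Finset ι) (ω : ι → ℝ)
    (x : ι → Fin (n + 1) → ℝ) (y : Fin (n + 1) → ℝ) :
    lorentzInner (∑ i ∈ s, ω i • x i) y = ∑ i ∈ s, ω i * lorentzInner (x i) y := by
  simp only [lorentzInner, Finset.sum_apply, Pi.smul_apply, smul_eq_mul, mul_add,
    Finset.sum_add_distrib, Finset.sum_mul, Finset.mul_sum, mul_neg, Finset.sum_neg_distrib,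
    mul_assoc]
  rw [Finset.sum_comm]

/-- The reverse Cauchy–Schwarz inequality on the hyperboloid, with its equality case. -/
theorem lorentzInner_le_neg_and_eq_iff {n : ℕ} {K : ℝ} (hK : 0 < K) {x y : Fin (n + 1) → ℝ}
    (hx : lorentzInner x x = -K) (hx0 : 0 < x 0) (hy : lorentzInner y y = -K) (hy0 : 0 < y 0) :
    lorentzInner x y ≤ -K ∧ (lorentzInner x y = -K ↔ x = y) := by
  have hcs := Finset.sum_mul_sq_le_sq_mul_sq univ (fun i : Fin n => x i.succ) (fun i => y i.succ)
  have hd : ∑ i : Fin n, (x i.succ - y i.succ) ^ 2 = ∑ i : Fin n, x i.succ ^ 2 +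
      ∑ i : Fin n, y i.succ ^ 2 - 2 * ∑ i : Fin n, x i.succ * y i.succ := by
    rw [Finset.mul_sum, ← Finset.sum_add_distrib, ← Finset.sum_sub_distrib]
    exact Finset.sum_congr rfl fun i _ => by ring
  have hd0 : 0 ≤ ∑ i : Fin n, (x i.succ - y i.succ) ^ 2 :=
    Finset.sum_nonneg fun i _ => sq_nonneg _
  have hmul := mul_pos hx0 hy0
  simp only [lorentzInner, ← pow_two] at hx hy
  have key : (K + ∑ i : Fin n, x i.succ * y i.succ) ^ 2 +
      K * ∑ i : Fin n, (x i.succ - y i.succ) ^ 2 ≤ (x 0 * y 0) ^ 2 := by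
    rw [mul_pow, show x 0 ^ 2 = K + ∑ i : Fin n, x i.succ ^ 2 by linarith,
      show y 0 ^ 2 = K + ∑ i : Fin n, y i.succ ^ 2 by linarith, hd]
    linarith
  refine ⟨?_, fun h => ?_, ?_⟩
  · have := abs_le_of_sq_le_sq (a := K + ∑ i : Fin n, x i.succ * y i.succ)
      (by nlinarith) hmul.le
    simp only [lorentzInner]
    linarith [le_of_abs_le this]
  · simp only [lorentzInner] at h
    rw [show x 0 * y 0 = K + ∑ i : Fin n, x i.succ * y i.succ by linarith] at key
    have hz : ∑ i : Fin n, (x i.succ - y i.succ) ^ 2 = 0 :=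
      le_antisymm (nonpos_of_mul_nonpos_right (by linarith) hK) hd0
    rw [Finset.sum_eq_zero_iff_of_nonneg fun i _ => sq_nonneg _] at hz
    have hs : ∀ i : Fin n, x i.succ = y i.succ := fun i =>
      sub_eq_zero.1 (pow_eq_zero_iff two_ne_zero |>.1 (hz i (mem_univ i)))
    simp only [hs] at hx
    have h0 : x 0 = y 0 := (sq_eq_sq₀ hx0.le hy0.le).1 (by linarith)
    exact funext (Fin.cases h0 hs)
  · rintro rfl
    simpa only [lorentzInner, ← pow_two] using hx

/-- A nontrivial nonnegative combination of points of the hyperboloid is time-like. -/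
theorem lorentzInner_sum_smul_self_neg {n : ℕ} {K : ℝ} (hK : 0 < K) {ι : Type*} [Fintype ι]
    {x : ι → Fin (n + 1) → ℝ} {ω : ι → ℝ} (hx : ∀ i, lorentzInner (x i) (x i) = -K)
    (hx0 : ∀ i, 0 < x i 0) (hω : ∀ i, 0 ≤ ω i) (hsum : 0 < ∑ i, ω i) :
    lorentzInner (∑ i, ω i • x i) (∑ i, ω i • x i) < 0 := by
  have hi : ∀ i, lorentzInner (x i) (∑ j, ω j • x j) ≤ (∑ j, ω j) * -K := fun i => by
    rw [lorentzInner_comm, lorentzInner_sum_smul_left, Finset.sum_mul]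
    exact Finset.sum_le_sum fun j _ => mul_le_mul_of_nonneg_left
      (lorentzInner_le_neg_and_eq_iff hK (hx j) (hx0 j) (hx i) (hx0 i)).1 (hω j)
  calc lorentzInner (∑ i, ω i • x i) (∑ i, ω i • x i)
      = ∑ i, ω i * lorentzInner (x i) (∑ j, ω j • x j) := lorentzInner_sum_smul_left _ _ _ _
    _ ≤ ∑ i, ω i * ((∑ j, ω j) * -K) :=
      Finset.sum_le_sum fun i _ => mul_le_mul_of_nonneg_left (hi i) (hω i)
    _ = -((∑ j, ω j) * (∑ j, ω j) * K) := by rw [← Finset.sum_mul]; ring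
    _ < 0 := neg_neg_of_pos (by positivity)

theorem sum_smul_zero_pos {n : ℕ} {ι : Type*} [Fintype ι]
    {x : ι → Fin (n + 1) → ℝ} {ω : ι → ℝ} (hx0 : ∀ i, 0 < x i 0) (hω : ∀ i, 0 ≤ ω i)
    (hsum : 0 < ∑ i, ω i) : 0 < (∑ i, ω i • x i) 0 := by
  obtain ⟨i, hi, hpos⟩ : ∃ i ∈ univ, 0 < ω i := by
    by_contra! h
    exact hsum.not_ge (Finset.sum_nonpos h)
  simp only [Finset.sum_apply, Pi.smul_apply, smul_eq_mul]
  exact Finset.sum_pos' (fun j _ => mul_nonneg (hω j) (hx0 j).le) ⟨i, hi, mul_pos hpos (hx0 i)⟩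

/-- **The Lorentzian focal point maximizes the weighted sum of Lorentzian scalar products.**
For points `x i` on `L^n_K` (`K > 0`), nonnegative weights `ω` with `∑ ω i > 0`, and
`a = ∑ ω i • x i`, the focal point `μF = √K • a / |‖a‖_L|` lies on `L^n_K`, satisfies
`⟨a, μF⟩_L = −√K · |‖a‖_L|`, and for every `μ ∈ L^n_K`:
`∑ ω i ⟨x i, μ⟩_L = ⟨a, μ⟩_L ≤ ⟨a, μF⟩_L` with equality iff `μ = μF`. -/
theorem lorentz_focal_point {n : ℕ} (hn : 1 ≤ n) {K : ℝ} (hK : 0 < K)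
    {m : ℕ} (x : Fin m → (Fin (n + 1) → ℝ)) (ω : Fin m → ℝ)
    (hx : ∀ i, lorentzInner (x i) (x i) = -K) (hx0 : ∀ i, 0 < x i 0)
    (hω : ∀ i, 0 ≤ ω i) (hsum : 0 < ∑ i, ω i) :
    ∀ a μF : Fin (n + 1) → ℝ,
      a = (∑ i, ω i • x i) →
      μF = (Real.sqrt K / Real.sqrt (-(lorentzInner a a))) • a →
      (lorentzInner μF μF = -K ∧ 0 < μF 0) ∧
      lorentzInner a μF = -(Real.sqrt K * Real.sqrt (-(lorentzInner a a))) ∧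
      (∀ μ : Fin (n + 1) → ℝ, lorentzInner μ μ = -K → 0 < μ 0 →
        (∑ i, ω i * lorentzInner (x i) μ) = lorentzInner a μ ∧
        lorentzInner a μ ≤ lorentzInner a μF ∧
        (lorentzInner a μ = lorentzInner a μF ↔ μ = μF)) := by
  rintro a μF ha hμF
  have haa : 0 < -lorentzInner a a := by
    rw [ha]
    exact neg_pos.2 (lorentzInner_sum_smul_self_neg hK hx hx0 hω hsum)
  have ha0 : 0 < a 0 := by
    rw [ha]
    exact sum_smul_zero_pos hx0 hω hsum
  have hN := Real.sqrt_pos.2 haa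
  have hN2 := Real.sq_sqrt haa.le
  have hsK := Real.sqrt_pos.2 hK
  have hK2 := Real.sq_sqrt hK.le
  set N := √(-lorentzInner a a)
  have hc : 0 < √K / N := div_pos hsK hN
  have hin : ∀ μ, lorentzInner μF μ = √K / N * lorentzInner a μ := fun μ => by
    rw [hμF, lorentzInner_smul_left]
  have hval : lorentzInner a μF = -(√K * N) := by
    rw [lorentzInner_comm, hin, show lorentzInner a a = -N ^ 2 by linarith]
    field_simp
  have hFF : lorentzInner μF μF = -K := by
    rw [hin, hval]
    field_simp
    linarith
  have hF0 : 0 < μF 0 := by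
    rw [hμF]
    exact mul_pos hc ha0
  refine ⟨⟨hFF, hF0⟩, hval, fun μ hμ hμ0 => ?_⟩
  obtain ⟨hle, heq⟩ := lorentzInner_le_neg_and_eq_iff hK hFF hF0 hμ hμ0
  rw [← hFF, hin, hin] at hle heq
  refine ⟨by rw [ha, lorentzInner_sum_smul_left], le_of_mul_le_mul_left hle hc, ?_⟩
  rw [eq_comm (a := μ), ← heq, mul_right_inj' hc.ne']
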